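/- arXiv:1809.07809 — 2 statements merged into one kernel-verified Lean document; each statement's English description precedes it below -/
import Mathlib

section
/- For all integers m > j ≥ 0 and every n ≥ 0, the Tribonacci-Lucas matrix sequence satisfies (K_m − K_{−m}) · ∑_{i=0}^{n−1} 𝒦_{mi+j} = 𝒦_{mn+m+j} + 𝒦_{mn−m+j} + (1 − K_m)·𝒦_{mn+j} − (𝒦_{m+j} + 𝒦_{j−m} + (1 − K_m)·𝒦_j), where K denotes the Tribonacci-Lucas numbers. -/
/-- The companion matrix of the Tribonacci recurrence, as a unit. -/
def tribC : (Matrix (Fin 3) (Fin 3) ℤ)ˣ where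
  val := !![0, 1, 0; 0, 0, 1; 1, 1, 1]
  inv := !![-1, -1, 1; 1, 0, 0; 0, 1, 0]
  val_inv := by decide
  inv_val := by decide

theorem trib_zero (f : ℤ → ℤ) (hf : ∀ n, f n = f (n - 1) + f (n - 2) + f (n - 3))
    (h0 : f 0 = 0) (h1 : f 1 = 0) (h2 : f 2 = 0) (n : ℤ) : f n = 0 := by
  suffices h : f n = 0 ∧ f (n + 1) = 0 ∧ f (n + 2) = 0 from h.1
  induction n using Int.induction_on with
  | zero => simp [h0, h1, h2]
  | succ i ih =>
    obtain ⟨a, b, c⟩ := ih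
    have h := hf (i + 3)
    ring_nf at *
    refine ⟨b, c, ?_⟩
    rw [h, a, b, c]; rfl
  | pred i ih =>
    obtain ⟨a, b, c⟩ := ih
    have h := hf (-i + 2)
    ring_nf at *
    refine ⟨?_, a, b⟩
    linarith

theorem tribC_rec (n : ℤ) : ((tribC ^ n : (Matrix (Fin 3) (Fin 3) ℤ)ˣ) : Matrix (Fin 3) (Fin 3) ℤ) =
    ((tribC ^ (n - 1) : (Matrix (Fin 3) (Fin 3) ℤ)ˣ) : Matrix (Fin 3) (Fin 3) ℤ) +
    ((tribC ^ (n - 2) : (Matrix (Fin 3) (Fin 3) ℤ)ˣ) : Matrix (Fin 3) (Fin 3) ℤ) +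
    ((tribC ^ (n - 3) : (Matrix (Fin 3) (Fin 3) ℤ)ˣ) : Matrix (Fin 3) (Fin 3) ℤ) := by
  have e0 : n = (n - 3) + 3 := by ring
  have e1 : n - 1 = (n - 3) + 2 := by ring
  have e2 : n - 2 = (n - 3) + 1 := by ring
  have hc : (tribC : Matrix (Fin 3) (Fin 3) ℤ) ^ 3 =
      (tribC : Matrix (Fin 3) (Fin 3) ℤ) ^ 2 + (tribC : Matrix (Fin 3) (Fin 3) ℤ) + 1 := by decide
  rw [e1, e2]
  conv_lhs => rw [e0]
  have z3 : tribC ^ (3 : ℤ) = tribC ^ 3 := rfl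
  have z2 : tribC ^ (2 : ℤ) = tribC ^ 2 := rfl
  rw [zpow_add, zpow_add, zpow_add, z3, z2, zpow_one]
  simp only [Units.val_mul, Units.val_pow_eq_pow_val, hc, mul_add, mul_one]

theorem trib_trace (K : ℤ → ℤ)
    (hK : ∀ n : ℤ, K n = K (n - 1) + K (n - 2) + K (n - 3))
    (hK0 : K 0 = 3) (hK1 : K 1 = 1) (hK2 : K 2 = 3) (n : ℤ) :
    K n = Matrix.trace ((tribC ^ n : (Matrix (Fin 3) (Fin 3) ℤ)ˣ) : Matrix (Fin 3) (Fin 3) ℤ) := by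
  have := trib_zero (fun n => K n -
    Matrix.trace ((tribC ^ n : (Matrix (Fin 3) (Fin 3) ℤ)ˣ) : Matrix (Fin 3) (Fin 3) ℤ))
    (by
      intro n
      have h := congrArg Matrix.trace (tribC_rec n)
      simp only [Matrix.trace_add] at h
      simp only [h]
      rw [hK n]; ring)
    (by simp [hK0])
    (by
      simp only [hK1, zpow_one]
      decide)
    (by
      have z2 : tribC ^ (2 : ℤ) = tribC ^ 2 := rfl
      simp only [hK2, z2, Units.val_pow_eq_pow_val]
      decide) n
  linarith

theorem trib_shift (a : ℤ → ℤ) (ha : ∀ n, a n = a (n - 1) + a (n - 2) + a (n - 3)) (k m : ℤ) :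
    Matrix.mulVec ((tribC ^ m : (Matrix (Fin 3) (Fin 3) ℤ)ˣ) : Matrix (Fin 3) (Fin 3) ℤ)
      ![a k, a (k + 1), a (k + 2)] = ![a (k + m), a (k + m + 1), a (k + m + 2)] := by
  induction m using Int.induction_on with
  | zero => simp
  | succ i ih =>
    rw [add_comm (i : ℤ) 1, zpow_add, zpow_one, Units.val_mul, ← Matrix.mulVec_mulVec, ih]
    have h := ha (k + i + 3)
    ext t
    fin_cases t <;> simp [tribC, Matrix.mulVec, dotProduct, Fin.sum_univ_three] <;> ring_nf at * <;> linarith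
  | pred i ih =>
    rw [sub_eq_add_neg, add_comm (-(i : ℤ)) (-1), zpow_add, zpow_neg_one, Units.val_mul,
      ← Matrix.mulVec_mulVec, ih]
    have h := ha (k - i + 2)
    have hi : ((tribC⁻¹ : (Matrix (Fin 3) (Fin 3) ℤ)ˣ) : Matrix (Fin 3) (Fin 3) ℤ) =
      !![-1, -1, 1; 1, 0, 0; 0, 1, 0] := rfl
    rw [hi]
    ext t
    fin_cases t <;> simp [Matrix.mulVec, dotProduct, Fin.sum_univ_three] <;> ring_nf at * <;> linarith

theorem cayley_three (A : Matrix (Fin 3) (Fin 3) ℤ) :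
    A * (A * A) = A.trace • (A * A) - A.adjugate.trace • A + A.det • 1 := by
  have ht : A.adjugate.trace = A 1 1 * A 2 2 - A 1 2 * A 2 1 + (A 0 0 * A 2 2 - A 0 2 * A 2 0) +
      (A 0 0 * A 1 1 - A 0 1 * A 1 0) := by
    rw [Matrix.adjugate_fin_three, Matrix.trace_fin_three]
    simp
  rw [ht, Matrix.trace_fin_three, Matrix.det_fin_three]
  ext i j
  simp only [Matrix.add_apply, Matrix.sub_apply, Matrix.smul_apply, Matrix.mul_apply,
    Fin.sum_univ_three, smul_eq_mul, Matrix.one_apply]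
  fin_cases i <;> fin_cases j <;> simp <;> ring

theorem tribC_det (m : ℤ) :
    ((tribC ^ m : (Matrix (Fin 3) (Fin 3) ℤ)ˣ) : Matrix (Fin 3) (Fin 3) ℤ).det = 1 := by
  have h1 : Units.map (Matrix.detMonoidHom : Matrix (Fin 3) (Fin 3) ℤ →* ℤ) tribC = 1 := by
    ext
    simp [tribC, Matrix.det_fin_three]
  have h : Units.map (Matrix.detMonoidHom : Matrix (Fin 3) (Fin 3) ℤ →* ℤ) (tribC ^ m) = 1 := by
    rw [map_zpow, h1, one_zpow]
  exact congrArg Units.val h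

theorem tribC_adj (m : ℤ) :
    ((tribC ^ m : (Matrix (Fin 3) (Fin 3) ℤ)ˣ) : Matrix (Fin 3) (Fin 3) ℤ).adjugate =
    ((tribC ^ (-m) : (Matrix (Fin 3) (Fin 3) ℤ)ˣ) : Matrix (Fin 3) (Fin 3) ℤ) := by
  have h := Matrix.mul_adjugate
    ((tribC ^ m : (Matrix (Fin 3) (Fin 3) ℤ)ˣ) : Matrix (Fin 3) (Fin 3) ℤ)
  rw [tribC_det, one_smul] at h
  rw [zpow_neg]
  exact (Units.inv_eq_of_mul_eq_one_right h).symm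

theorem trib_key (K : ℤ → ℤ)
    (hK : ∀ n : ℤ, K n = K (n - 1) + K (n - 2) + K (n - 3))
    (hK0 : K 0 = 3) (hK1 : K 1 = 1) (hK2 : K 2 = 3)
    (a : ℤ → ℤ) (ha : ∀ n, a n = a (n - 1) + a (n - 2) + a (n - 3)) (k m : ℤ) :
    a (k + m + m + m) = K m * a (k + m + m) - K (-m) * a (k + m) + a k := by
  have h := cayley_three ((tribC ^ m : (Matrix (Fin 3) (Fin 3) ℤ)ˣ) : Matrix (Fin 3) (Fin 3) ℤ)
  rw [tribC_det, tribC_adj, ← trib_trace K hK hK0 hK1 hK2, ← trib_trace K hK hK0 hK1 hK2] at h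
  have h' := congrArg (fun M => Matrix.mulVec M ![a k, a (k + 1), a (k + 2)] 0) h
  simp only [Matrix.add_mulVec, Matrix.sub_mulVec, Matrix.smul_mulVec, ← Matrix.mulVec_mulVec,
    trib_shift a ha, Matrix.one_mulVec] at h'
  simpa using h'


theorem tribonacci_lucas_matrix_sum
    (K : ℤ → ℤ)
    (hK : ∀ n : ℤ, K n = K (n - 1) + K (n - 2) + K (n - 3))
    (hK0 : K 0 = 3) (hK1 : K 1 = 1) (hK2 : K 2 = 3)
    (𝒦 : ℤ → Matrix (Fin 3) (Fin 3) ℤ)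
    (h𝒦 : ∀ n : ℤ, 𝒦 n = 𝒦 (n - 1) + 𝒦 (n - 2) + 𝒦 (n - 3))
    (h𝒦0 : 𝒦 0 = !![1, 2, 3; 3, -2, -1; -1, 4, -1])
    (h𝒦1 : 𝒦 1 = !![3, 4, 1; 1, 2, 3; 3, -2, -1])
    (h𝒦2 : 𝒦 2 = !![7, 4, 3; 3, 4, 1; 1, 2, 3])
    (m j : ℤ) (hj : 0 ≤ j) (hjm : j < m) :
    ∀ n : ℕ,
      (K m - K (-m)) • (∑ i ∈ Finset.range n, 𝒦 (m * (i : ℤ) + j)) =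
        𝒦 (m * (n : ℤ) + m + j) + 𝒦 (m * (n : ℤ) - m + j) +
          (1 - K m) • 𝒦 (m * (n : ℤ) + j) -
        (𝒦 (m + j) + 𝒦 (j - m) + (1 - K m) • 𝒦 j) := by
  intro n
  ext p q
  have ha : ∀ n, 𝒦 n p q = 𝒦 (n - 1) p q + 𝒦 (n - 2) p q + 𝒦 (n - 3) p q := by
    intro n
    have := congrArg (fun M => M p q) (h𝒦 n)
    simpa using this
  simp only [Matrix.smul_apply, Matrix.sum_apply, Matrix.add_apply, Matrix.sub_apply, smul_eq_mul]
  induction n with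
  | zero =>
    simp [sub_eq_add_neg, add_comm, add_left_comm]
  | succ n ih =>
    rw [Finset.sum_range_succ, mul_add, ih]
    have key := trib_key K hK hK0 hK1 hK2 (fun n => 𝒦 n p q) ha (m * n - m + j) m
    push_cast
    have e1 : m * (n : ℤ) - m + j + m + m + m = m * (n + 1) + m + j := by ring
    have e2 : m * (n : ℤ) - m + j + m + m = m * (n + 1) + j := by ring
    have e3 : m * (n : ℤ) - m + j + m = m * n + j := by ring
    have e4 : m * ((n : ℤ) + 1) - m + j = m * n + j := by ring
    have e5 : m * (n : ℤ) + m + j = m * (n + 1) + j := by ring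
    rw [e1, e2, e3] at key
    rw [e4, e5, key]
    ring
end

section
/- For all non-negative integers m, n and r with n ≥ r: (a) 𝒦_{n−r} · 𝒦_{n+r} = 𝒦_n²; (b) 𝒦_n^m = 𝒦_0^m · 𝒯_{mn} (matrix powers with respect to matrix multiplication). -/
theorem trib_aux (A C : Matrix (Fin 3) (Fin 3) ℤ) (hA : A ^ 3 = A ^ 2 + A + 1)
    (F : ℤ → Matrix (Fin 3) (Fin 3) ℤ)
    (hF : ∀ n : ℤ, F n = F (n - 1) + F (n - 2) + F (n - 3))
    (h0 : F 0 = C) (h1 : F 1 = C * A) (h2 : F 2 = C * A ^ 2) (n : ℕ) :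
    F n = C * A ^ n ∧ F ((n : ℤ) + 1) = C * A ^ (n + 1) ∧ F ((n : ℤ) + 2) = C * A ^ (n + 2) := by
  induction n with
  | zero => simp [h0, h1, h2]
  | succ k ih =>
    obtain ⟨a, b, c⟩ := ih
    refine ⟨by push_cast; exact b, ?_, ?_⟩
    · push_cast
      rw [show (k : ℤ) + 1 + 1 = k + 2 by ring]; exact c
    · push_cast
      rw [hF, show (k : ℤ) + 1 + 2 - 1 = k + 2 by ring, show (k : ℤ) + 1 + 2 - 2 = k + 1 by ring,
        show (k : ℤ) + 1 + 2 - 3 = k by ring, a, b, c, show k + 1 + 2 = k + 3 by ring,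
        pow_add A k 3, hA]
      noncomm_ring

theorem tribonacci_lucas_matrix_powers
    (𝒯 : ℤ → Matrix (Fin 3) (Fin 3) ℤ)
    (h𝒯 : ∀ n : ℤ, 𝒯 n = 𝒯 (n - 1) + 𝒯 (n - 2) + 𝒯 (n - 3))
    (h𝒯0 : 𝒯 0 = 1)
    (h𝒯1 : 𝒯 1 = !![1, 1, 1; 1, 0, 0; 0, 1, 0])
    (h𝒯2 : 𝒯 2 = !![2, 2, 1; 1, 1, 1; 1, 0, 0])
    (𝒦 : ℤ → Matrix (Fin 3) (Fin 3) ℤ)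
    (h𝒦 : ∀ n : ℤ, 𝒦 n = 𝒦 (n - 1) + 𝒦 (n - 2) + 𝒦 (n - 3))
    (h𝒦0 : 𝒦 0 = !![1, 2, 3; 3, -2, -1; -1, 4, -1])
    (h𝒦1 : 𝒦 1 = !![3, 4, 1; 1, 2, 3; 3, -2, -1])
    (h𝒦2 : 𝒦 2 = !![7, 4, 3; 3, 4, 1; 1, 2, 3]) :
    ∀ m n r : ℕ, r ≤ n →
      (𝒦 ((n : ℤ) - r) * 𝒦 ((n : ℤ) + r) = 𝒦 (n : ℤ) ^ 2) ∧
      (𝒦 (n : ℤ) ^ m = 𝒦 0 ^ m * 𝒯 ((m : ℤ) * n)) := by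
  intro m n r hr
  obtain ⟨A, hAdef⟩ : ∃ A : Matrix (Fin 3) (Fin 3) ℤ, A = !![1, 1, 1; 1, 0, 0; 0, 1, 0] := ⟨_, rfl⟩
  have hA : A ^ 3 = A ^ 2 + A + 1 := by subst hAdef; decide
  have hT : ∀ k : ℕ, 𝒯 k = A ^ k := fun k => by
    have := (trib_aux A 1 hA 𝒯 h𝒯 h𝒯0 (by rw [h𝒯1, hAdef, one_mul])
      (by rw [h𝒯2, hAdef]; decide) k).1
    rwa [one_mul] at this
  have hK : ∀ k : ℕ, 𝒦 k = 𝒦 0 * A ^ k := fun k =>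
    (trib_aux A (𝒦 0) hA 𝒦 h𝒦 rfl (by rw [h𝒦1, h𝒦0, hAdef]; decide)
      (by rw [h𝒦2, h𝒦0, hAdef]; decide) k).1
  have hc : Commute (𝒦 0) A := by
    rw [h𝒦0, hAdef]; unfold Commute SemiconjBy; decide
  constructor
  · rw [← Nat.cast_sub hr, ← Nat.cast_add, hK, hK, hK, pow_two, mul_assoc, mul_assoc,
      ← mul_assoc (A ^ (n - r)), ← mul_assoc (A ^ n), ← (hc.pow_right _).eq, ← (hc.pow_right _).eq,
      mul_assoc, mul_assoc, ← pow_add, ← pow_add,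
      show n - r + (n + r) = n + n by omega]
  · rw [← Nat.cast_mul, hT, hK, (hc.pow_right n).mul_pow, ← pow_mul, mul_comm n m]
end
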